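/- arXiv:2105.03657 — 3 statements merged into one kernel-verified Lean document; each statement's English description precedes it below -/
import Mathlib

section
/- Let (Ω, 𝒜, μ) be a probability space, n, m ≥ 1 integers, and f_1, …, f_m : Ω^n → [0,∞) measurable functions such that each f_i depends only on the coordinates in a subset B_i ⊆ {1,…,n}. Let p_1, …, p_m ≥ 1 be real numbers such that for every j ∈ {1,…,n}, the sum of 1/p_i over all i with j ∈ B_i is at most 1. Then ∫_{Ω^n} f_1 ⋯ f_m dμ^n ≤ ‖f_1‖_{p_1} ⋯ ‖f_m‖_{p_m}. -/
open MeasureTheory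
open scoped ENNReal

/-- Hölder's inequality for finitely many functions on a probability space, with weights of sum at
most `1`. -/
theorem lintegral_prod_rpow_le_of_sum_le_one {α ι : Type*} [MeasurableSpace α] {μ : Measure α}
    [IsProbabilityMeasure μ] (s : Finset ι) {f : ι → α → ℝ≥0∞} (hf : ∀ i ∈ s, AEMeasurable (f i) μ)
    {w : ι → ℝ} (hw : ∀ i ∈ s, 0 ≤ w i) (hsum : ∑ i ∈ s, w i ≤ 1) :
    ∫⁻ a, ∏ i ∈ s, f i a ^ w i ∂μ ≤ ∏ i ∈ s, (∫⁻ a, f i a ∂μ) ^ w i := by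
  simpa using ENNReal.lintegral_mul_prod_norm_pow_le s (g := fun _ ↦ 1) aemeasurable_const hf
    (1 - ∑ i ∈ s, w i) (sub_add_cancel _ _) (sub_nonneg.2 hsum) hw

/-- Integrating out some variables of a function that does not depend on the `j`-th coordinate
gives a function that does not depend on the `j`-th coordinate. -/
theorem lmarginal_update_of_dependsOn {δ : Type*} [DecidableEq δ] {X : δ → Type*}
    [∀ j, MeasurableSpace (X j)] (μ : ∀ j, Measure (X j)) {f : (∀ j, X j) → ℝ≥0∞} {B : Set δ}
    (hf : DependsOn f B) {j : δ} (hj : j ∉ B) (s : Finset δ) (x : ∀ j, X j) (t : X j) :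
    (∫⋯∫⁻_s, f ∂μ) (Function.update x j t) = (∫⋯∫⁻_s, f ∂μ) x := by
  refine lintegral_congr fun y ↦ hf fun k hk ↦ ?_
  have hkj : k ≠ j := fun h ↦ hj (h ▸ hk)
  simp [Function.updateFinset, hkj]

/-- Finner's inequality for iterated integrals over a finite set of coordinates. -/
theorem lmarginal_prod_rpow_le {δ ι : Type*} [DecidableEq δ] [Fintype ι] {X : δ → Type*}
    [∀ j, MeasurableSpace (X j)] (μ : ∀ j, Measure (X j)) [∀ j, IsProbabilityMeasure (μ j)]
    {f : ι → (∀ j, X j) → ℝ≥0∞} (hf : ∀ i, Measurable (f i)) {B : ι → Finset δ}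
    (hdep : ∀ i, DependsOn (f i) (B i)) {w : ι → ℝ} (hw : ∀ i, 0 ≤ w i)
    (hsum : ∀ j, ∑ i with j ∈ B i, w i ≤ 1) (s : Finset δ) (x : ∀ j, X j) :
    (∫⋯∫⁻_s, (fun y ↦ ∏ i, f i y ^ w i) ∂μ) x ≤ ∏ i, (∫⋯∫⁻_s, f i ∂μ) x ^ w i := by
  induction s using Finset.induction_on generalizing x with
  | empty => simp
  | insert j s hj ih =>
    have hmarg (i) : Measurable fun t ↦ (∫⋯∫⁻_s, f i ∂μ) (Function.update x j t) :=
      ((hf i).lmarginal μ).comp (measurable_update x)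
    have hconst {i} (hi : j ∉ B i) (t) :
        (∫⋯∫⁻_s, f i ∂μ) (Function.update x j t) = (∫⋯∫⁻_s, f i ∂μ) x :=
      lmarginal_update_of_dependsOn μ (hdep i) (by simpa using hi) s x t
    have hout : ∏ i with j ∉ B i, (∫⋯∫⁻_insert j s, f i ∂μ) x ^ w i =
        ∏ i with j ∉ B i, (∫⋯∫⁻_s, f i ∂μ) x ^ w i :=
      Finset.prod_congr rfl fun i hi ↦ by
        simp [lmarginal_insert _ (hf i) hj, hconst (Finset.mem_filter.1 hi).2]
    rw [lmarginal_insert _ (Finset.measurable_fun_prod _ fun i _ ↦ (hf i).pow_const _) hj]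
    calc
      _ ≤ ∫⁻ t, ∏ i, (∫⋯∫⁻_s, f i ∂μ) (Function.update x j t) ^ w i ∂μ j :=
        lintegral_mono fun t ↦ ih _
      _ = ∫⁻ t, (∏ i with j ∉ B i, (∫⋯∫⁻_s, f i ∂μ) x ^ w i) *
          ∏ i with j ∈ B i, (∫⋯∫⁻_s, f i ∂μ) (Function.update x j t) ^ w i ∂μ j := by
        refine lintegral_congr fun t ↦ ?_
        rw [← Finset.prod_filter_mul_prod_filter_not _ (fun i ↦ j ∈ B i), mul_comm]
        congr 1
        exact Finset.prod_congr rfl fun i hi ↦ by rw [hconst (Finset.mem_filter.1 hi).2]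
      _ = (∏ i with j ∉ B i, (∫⋯∫⁻_s, f i ∂μ) x ^ w i) *
          ∫⁻ t, ∏ i with j ∈ B i, (∫⋯∫⁻_s, f i ∂μ) (Function.update x j t) ^ w i ∂μ j :=
        lintegral_const_mul _ (Finset.measurable_fun_prod _ fun i _ ↦ (hmarg i).pow_const _)
      _ ≤ (∏ i with j ∉ B i, (∫⋯∫⁻_s, f i ∂μ) x ^ w i) *
          ∏ i with j ∈ B i, (∫⋯∫⁻_insert j s, f i ∂μ) x ^ w i := by
        gcongr
        simp_rw [lmarginal_insert _ (hf _) hj]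
        exact lintegral_prod_rpow_le_of_sum_le_one _ (fun i _ ↦ (hmarg i).aemeasurable)
          (fun i _ ↦ hw i) (hsum j)
      _ = _ := by
        rw [← hout, mul_comm, Finset.prod_filter_mul_prod_filter_not]

/-- **Finner's inequality** on a finite product of probability spaces. -/
theorem lintegral_pi_prod_rpow_le {δ ι : Type*} [Fintype δ] [DecidableEq δ] [Fintype ι]
    {X : δ → Type*} [∀ j, MeasurableSpace (X j)] (μ : ∀ j, Measure (X j))
    [∀ j, IsProbabilityMeasure (μ j)] {f : ι → (∀ j, X j) → ℝ≥0∞} (hf : ∀ i, Measurable (f i))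
    {B : ι → Finset δ} (hdep : ∀ i, DependsOn (f i) (B i)) {w : ι → ℝ} (hw : ∀ i, 0 ≤ w i)
    (hsum : ∀ j, ∑ i with j ∈ B i, w i ≤ 1) :
    ∫⁻ x, ∏ i, f i x ^ w i ∂Measure.pi μ ≤ ∏ i, (∫⁻ x, f i x ∂Measure.pi μ) ^ w i := by
  have (j : δ) : Nonempty (X j) := nonempty_of_isProbabilityMeasure (μ j)
  simpa using lmarginal_prod_rpow_le μ hf hdep hw hsum Finset.univ fun _ ↦ Classical.arbitrary _

/-- **Finner's generalized Hölder inequality (Lemma 4.1).** Let `(Ω, μ)` be a probability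
space and `f_1, …, f_m : Ω^n → [0,∞)` measurable, each `f_i` depending only on the
coordinates in `B_i ⊆ {1,…,n}`. If `p_1, …, p_m ≥ 1` satisfy
`∑_{i : j ∈ B_i} 1/p_i ≤ 1` for every coordinate `j`, then
`∫ f_1 ⋯ f_m dμ^n ≤ ‖f_1‖_{p_1} ⋯ ‖f_m‖_{p_m}`. -/
theorem finner_generalized_holder
    {Ω : Type*} [MeasurableSpace Ω] (μ : Measure Ω) [IsProbabilityMeasure μ]
    (n m : ℕ) (hn : 1 ≤ n) (hm : 1 ≤ m)
    (f : Fin m → (Fin n → Ω) → ℝ)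
    (hmeas : ∀ i, Measurable (f i))
    (hnonneg : ∀ i x, 0 ≤ f i x)
    (B : Fin m → Finset (Fin n))
    (hdep : ∀ i, ∀ x y : Fin n → Ω, (∀ j ∈ B i, x j = y j) → f i x = f i y)
    (p : Fin m → ℝ) (hp : ∀ i, 1 ≤ p i)
    (hsum : ∀ j : Fin n, ∑ i ∈ Finset.univ.filter (fun i => j ∈ B i), 1 / p i ≤ 1) :
    ∫⁻ x, ∏ i, ENNReal.ofReal (f i x) ∂(Measure.pi fun _ => μ) ≤
      ∏ i, (∫⁻ x, ENNReal.ofReal (f i x) ^ (p i) ∂(Measure.pi fun _ => μ)) ^ (1 / p i) := by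
  have hp₀ (i) : 0 < p i := zero_lt_one.trans_le (hp i)
  have key := lintegral_pi_prod_rpow_le (fun _ : Fin n ↦ μ)
    (f := fun i x ↦ ENNReal.ofReal (f i x) ^ p i)
    (fun i ↦ (hmeas i).ennreal_ofReal.pow_const _) (B := B)
    (fun i x y h ↦ by simp only [hdep i x y h]) (w := fun i ↦ 1 / p i)
    (fun i ↦ (one_div_pos.2 (hp₀ i)).le) hsum
  simpa only [← ENNReal.rpow_mul, mul_one_div_cancel (hp₀ _).ne', ENNReal.rpow_one] using key
end

section
/- Let G = (V,E) be a simple connected graph on n ≥ 2 vertices with all degrees at most D, let e_1 ∈ E, and let w : E → [0,∞). Then there is a spanning tree F of G and integers (k_e : e ∈ E(F)) such that k_{e_1} = 1 (with e_1 ∈ E(F)), 1 ≤ k_e ≤ D for all e ∈ E(F), Σ_{e ∈ E(F)} k_e = |E(G)|, and Σ_{e ∈ E(G)} w(e) ≤ Σ_{e ∈ E(F)} k_e · w(e). -/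
open scoped Classical

namespace SimpleGraph

variable {V : Type*} [Fintype V] (G : SimpleGraph V)

/-- The edges of `G` with both endpoints in `S`. -/
noncomputable def edgesIn (S : Finset V) : Finset (Sym2 V) :=
  G.edgeFinset.filter (fun e => ∀ x ∈ e, x ∈ S)

/-- The edges of `G` joining `v` to a vertex of `S`. -/
noncomputable def edgesTo (S : Finset V) (v : V) : Finset (Sym2 V) :=
  (S.filter (fun x => G.Adj x v)).image (fun x => s(x, v))

/-- `A` and `k` are the edge set and the multiplicities of a weighted spanning tree of `G[S]`,
rooted at `a`, whose distinguished edge is `e₁`. -/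
structure IsPartialTree (D : ℕ) (e₁ : Sym2 V) (w : Sym2 V → ℝ) (a : V) (S : Finset V)
    (A : Finset (Sym2 V)) (k : Sym2 V → ℕ) : Prop where
  subset : A ⊆ G.edgesIn S
  root_mem : a ∈ S
  mem : e₁ ∈ A
  mult_eq_one : k e₁ = 1
  bound : ∀ e ∈ A, 1 ≤ k e ∧ k e ≤ D
  sum_mult : ∑ e ∈ A, k e = (G.edgesIn S).card
  sum_weight : ∑ e ∈ G.edgesIn S, w e ≤ ∑ e ∈ A, (k e : ℝ) * w e
  reachable : ∀ x ∈ S, (fromEdgeSet (A : Set (Sym2 V))).Reachable a x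
  card_eq : A.card + 1 = S.card

variable {G}

theorem mem_edgesIn {S : Finset V} {x y : V} :
    s(x, y) ∈ G.edgesIn S ↔ G.Adj x y ∧ x ∈ S ∧ y ∈ S := by
  simp [edgesIn]

theorem edgesIn_insert (S : Finset V) (v : V) :
    G.edgesIn (insert v S) = G.edgesIn S ∪ G.edgesTo S v := by
  ext e
  induction e with | _ x y =>
  simp only [Finset.mem_union, mem_edgesIn, edgesTo, Finset.mem_image, Finset.mem_filter,
    Finset.mem_insert, Sym2.eq_iff]
  constructor
  · rintro ⟨h, rfl | hx, rfl | hy⟩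
    · exact absurd h (G.loopless.irrefl _)
    · exact .inr ⟨y, ⟨hy, h.symm⟩, .inr ⟨rfl, rfl⟩⟩
    · exact .inr ⟨x, ⟨hx, h⟩, .inl ⟨rfl, rfl⟩⟩
    · exact .inl ⟨h, hx, hy⟩
  · rintro (⟨h, hx, hy⟩ | ⟨z, ⟨hz, h⟩, ⟨rfl, rfl⟩ | ⟨rfl, rfl⟩⟩)
    · exact ⟨h, .inr hx, .inr hy⟩
    · exact ⟨h, .inr hz, .inl rfl⟩
    · exact ⟨h.symm, .inl rfl, .inr hz⟩

theorem disjoint_edgesIn_edgesTo {S : Finset V} {v : V} (hv : v ∉ S) :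
    Disjoint (G.edgesIn S) (G.edgesTo S v) := by
  rw [Finset.disjoint_left]
  intro e he h
  obtain ⟨x, -, rfl⟩ := Finset.mem_image.1 h
  exact hv (mem_edgesIn.1 he).2.2

theorem card_edgesTo_le {D : ℕ} (hdeg : ∀ v : V, G.degree v ≤ D) (S : Finset V) (v : V) :
    (G.edgesTo S v).card ≤ D := by
  refine Finset.card_image_le.trans (le_trans ?_ (hdeg v))
  rw [← card_neighborFinset_eq_degree]
  refine Finset.card_le_card fun x hx => ?_
  rw [mem_neighborFinset]
  exact (Finset.mem_filter.1 hx).2.symm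

theorem isPartialTree_pair {D : ℕ} (hdeg : ∀ v : V, G.degree v ≤ D) (w : Sym2 V → ℝ) {a b : V}
    (hab : G.Adj a b) : G.IsPartialTree D s(a, b) w a {a, b} {s(a, b)} (fun _ => 1) := by
  have hE : G.edgesIn {a, b} = {s(a, b)} := by
    ext e
    induction e with | _ x y =>
    simp only [mem_edgesIn, Finset.mem_insert, Finset.mem_singleton, Sym2.eq_iff]
    constructor
    · rintro ⟨h, rfl | rfl, rfl | rfl⟩ <;> simp_all
    · rintro (⟨rfl, rfl⟩ | ⟨rfl, rfl⟩) <;> simp [hab, hab.symm]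
  have hD : 1 ≤ D :=
    Nat.lt_of_lt_of_le ((G.degree_pos_iff_exists_adj a).2 ⟨b, hab⟩) (hdeg a)
  constructor <;> simp [hE, hD, Finset.card_pair hab.ne]
  exact Adj.reachable (by simp [hab.ne])

/-- There is a heaviest edge among those leaving `S`. -/
theorem exists_max_boundary_edge (hG : G.Connected) (w : Sym2 V → ℝ) {S : Finset V} {a : V}
    (ha : a ∈ S) (hS : S ≠ Finset.univ) :
    ∃ u ∈ S, ∃ v ∉ S, G.Adj u v ∧ ∀ x ∈ S, G.Adj x v → w s(x, v) ≤ w s(u, v) := by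
  obtain ⟨y, hy⟩ : ∃ y, y ∉ S := by simpa [Finset.eq_univ_iff_forall] using hS
  obtain ⟨p⟩ := hG.preconnected a y
  obtain ⟨d, -, hd₁, hd₂⟩ := p.exists_boundary_dart (S : Set V) ha hy
  let B : Finset (V × V) := Finset.univ.filter fun q => q.1 ∈ S ∧ q.2 ∉ S ∧ G.Adj q.1 q.2
  obtain ⟨q, hq, hmax⟩ := B.exists_max_image (fun q => w s(q.1, q.2))
    ⟨d.toProd, Finset.mem_filter.2 ⟨Finset.mem_univ _, hd₁, hd₂, d.adj⟩⟩
  simp only [B, Finset.mem_filter, Finset.mem_univ, true_and] at hq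
  exact ⟨q.1, hq.1, q.2, hq.2.1, hq.2.2, fun x hx h =>
    hmax (x, q.2) (Finset.mem_filter.2 ⟨Finset.mem_univ _, hx, hq.2.1, h⟩)⟩

theorem IsPartialTree.insert {D : ℕ} (hdeg : ∀ v : V, G.degree v ≤ D) {e₁ : Sym2 V}
    {w : Sym2 V → ℝ} {a : V} {S : Finset V} {A : Finset (Sym2 V)} {k : Sym2 V → ℕ}
    (h : G.IsPartialTree D e₁ w a S A k) {u v : V} (hu : u ∈ S) (hv : v ∉ S) (huv : G.Adj u v)
    (hmax : ∀ x ∈ S, G.Adj x v → w s(x, v) ≤ w s(u, v)) :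
    G.IsPartialTree D e₁ w a (insert v S) (insert s(u, v) A)
      (Function.update k s(u, v) (G.edgesTo S v).card) := by
  have hmem : s(u, v) ∈ G.edgesTo S v :=
    Finset.mem_image.2 ⟨u, Finset.mem_filter.2 ⟨hu, huv⟩, rfl⟩
  have hnot : s(u, v) ∉ A := fun hA =>
    Finset.disjoint_left.1 (disjoint_edgesIn_edgesTo hv) (h.subset hA) hmem
  have hk : ∀ e ∈ A, Function.update k s(u, v) (G.edgesTo S v).card e = k e := fun e he =>
    Function.update_of_ne (ne_of_mem_of_not_mem he hnot) _ _
  have hreach : ∀ x ∈ S,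
      (fromEdgeSet ((Insert.insert s(u, v) A : Finset (Sym2 V)) : Set (Sym2 V))).Reachable a x :=
    fun x hx => (h.reachable x hx).mono (fromEdgeSet_mono (by simp))
  constructor
  · rw [edgesIn_insert]
    exact Finset.insert_subset (Finset.mem_union_right _ hmem)
      (h.subset.trans Finset.subset_union_left)
  · exact Finset.mem_insert_of_mem h.root_mem
  · exact Finset.mem_insert_of_mem h.mem
  · rw [hk _ h.mem, h.mult_eq_one]
  · intro e he
    rcases Finset.mem_insert.1 he with rfl | he
    · rw [Function.update_self]
      exact ⟨Finset.card_pos.2 ⟨_, hmem⟩, card_edgesTo_le hdeg S v⟩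
    · rw [hk e he]
      exact h.bound e he
  · rw [Finset.sum_insert hnot, Function.update_self, Finset.sum_congr rfl hk, h.sum_mult,
      edgesIn_insert, Finset.card_union_of_disjoint (disjoint_edgesIn_edgesTo hv), add_comm]
  · rw [Finset.sum_insert hnot, Function.update_self, edgesIn_insert,
      Finset.sum_union (disjoint_edgesIn_edgesTo hv), add_comm]
    refine add_le_add ?_ (h.sum_weight.trans_eq ?_)
    · rw [← nsmul_eq_mul]
      refine Finset.sum_le_card_nsmul _ _ _ fun e he => ?_
      obtain ⟨x, hx, rfl⟩ := Finset.mem_image.1 he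
      exact hmax x (Finset.mem_filter.1 hx).1 (Finset.mem_filter.1 hx).2
    · exact Finset.sum_congr rfl fun e he => by rw [hk e he]
  · intro x hx
    rcases Finset.mem_insert.1 hx with rfl | hx
    · exact (hreach u hu).trans (Adj.reachable (by simp [huv.ne]))
    · exact hreach x hx
  · rw [Finset.card_insert_of_notMem hnot, Finset.card_insert_of_notMem hv, h.card_eq]

theorem exists_isPartialTree_univ (hG : G.Connected) {D : ℕ} (hdeg : ∀ v : V, G.degree v ≤ D)
    (w : Sym2 V → ℝ) {a b : V} (hab : G.Adj a b) :
    ∃ A k, G.IsPartialTree D s(a, b) w a Finset.univ A k := by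
  obtain ⟨S, hS, hmax⟩ := Finset.exists_max_image
    (Finset.univ.filter fun S => ∃ A k, G.IsPartialTree D s(a, b) w a S A k) Finset.card
    ⟨_, Finset.mem_filter.2 ⟨Finset.mem_univ _, _, _, isPartialTree_pair hdeg w hab⟩⟩
  obtain ⟨A, k, h⟩ := (Finset.mem_filter.1 hS).2
  by_cases hS : S = Finset.univ
  · exact ⟨A, k, hS ▸ h⟩
  obtain ⟨u, hu, v, hv, huv, hw⟩ := exists_max_boundary_edge hG w h.root_mem hS
  have := hmax _ (Finset.mem_filter.2 ⟨Finset.mem_univ _, _, _, h.insert hdeg hu hv huv hw⟩)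
  rw [Finset.card_insert_of_notMem hv] at this
  omega

end SimpleGraph

/-- **Lemma 4.5.** Let `G` be a simple connected graph on `n ≥ 2` nodes with all degrees
at most `D`, let `e₁` be an edge of `G` and `w : E → [0,∞)` a weight function. Then there
is a spanning tree `F` of `G` and integers `(k_e : e ∈ E(F))` with `k_{e₁} = 1`,
`1 ≤ k_e ≤ D` for all `e ∈ E(F)`, `∑_{e ∈ E(F)} k_e = |E(G)|`, and
`∑_{e ∈ E(G)} w(e) ≤ ∑_{e ∈ E(F)} k_e · w(e)`. -/
theorem spanning_tree_weight_lemma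
    {V : Type*} [Fintype V] [DecidableEq V]
    (G : SimpleGraph V) (hG : G.Connected) (hcard : 2 ≤ Fintype.card V)
    (D : ℕ) (hdeg : ∀ v : V, G.degree v ≤ D)
    (e₁ : Sym2 V) (he₁ : e₁ ∈ G.edgeSet)
    (w : Sym2 V → ℝ) (hw : ∀ e ∈ G.edgeSet, 0 ≤ w e) :
    ∃ (F : SimpleGraph V) (k : Sym2 V → ℕ),
      F ≤ G ∧ F.IsTree ∧
      e₁ ∈ F.edgeSet ∧ k e₁ = 1 ∧
      (∀ e ∈ F.edgeFinset, 1 ≤ k e ∧ k e ≤ D) ∧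
      (∑ e ∈ F.edgeFinset, k e) = G.edgeFinset.card ∧
      (∑ e ∈ G.edgeFinset, w e) ≤ ∑ e ∈ F.edgeFinset, (k e : ℝ) * w e := by
  induction e₁ with | _ a b =>
  obtain ⟨A, k, h⟩ := SimpleGraph.exists_isPartialTree_univ hG hdeg w he₁
  have hE : G.edgesIn Finset.univ = G.edgeFinset := by
    ext e
    simp [SimpleGraph.edgesIn]
  have hsub : A ⊆ G.edgeFinset := hE ▸ h.subset
  obtain ⟨F, hF⟩ : ∃ F, F = SimpleGraph.fromEdgeSet (A : Set (Sym2 V)) := ⟨_, rfl⟩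
  have hedge : F.edgeSet = A := by
    rw [hF, SimpleGraph.edgeSet_fromEdgeSet, sdiff_eq_left, Set.disjoint_left]
    exact fun e he => G.not_isDiag_of_mem_edgeSet (SimpleGraph.mem_edgeFinset.1 (hsub he))
  have hfin : F.edgeFinset = A := by
    ext e
    rw [SimpleGraph.mem_edgeFinset, hedge, Finset.mem_coe]
  refine ⟨F, k, ?_, ?_, ?_, h.mult_eq_one, ?_, ?_, ?_⟩
  · rw [← SimpleGraph.edgeSet_subset_edgeSet, hedge]
    exact fun e he => SimpleGraph.mem_edgeFinset.1 (hsub he)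
  · rw [SimpleGraph.isTree_iff_connected_and_card, hedge]
    have : Nonempty V := ⟨a⟩
    refine ⟨⟨fun x y => hF ▸ (h.reachable x (Finset.mem_univ x)).symm.trans
      (h.reachable y (Finset.mem_univ y))⟩, ?_⟩
    simpa using h.card_eq
  · rw [hedge]
    exact h.mem
  · rw [hfin]
    exact h.bound
  · rw [hfin, h.sum_mult, hE]
  · rw [hfin, ← hE]
    exact h.sum_weight
end

section
/- ∫_{[0,π]³} (1 - (cos α cos β - sin α sin β cos θ)²)^{-1/2} dα dβ dθ = (π⁴/2) · Σ_{r=0}^{∞} (4r+1) · 4^{-6r} · C(2r, r)⁶, where C(2r, r) is the central binomial coefficient. -/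
open MeasureTheory
open scoped ENNReal

open Finset Polynomial

/-- The normalized central binomial coefficient `4⁻ⁿ C(2n, n)`. -/
noncomputable def centralRatio (n : ℕ) : ℝ := (n.centralBinom : ℝ) / 4 ^ n

theorem centralRatio_zero : centralRatio 0 = 1 := by simp [centralRatio]

theorem centralRatio_nonneg (n : ℕ) : 0 ≤ centralRatio n := by
  unfold centralRatio; positivity

theorem centralRatio_succ (n : ℕ) :
    centralRatio (n + 1) = (2 * n + 1) / (2 * n + 2) * centralRatio n := by
  have h : ((n : ℝ) + 1) * (n + 1).centralBinom = 2 * (2 * n + 1) * n.centralBinom :=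
    mod_cast Nat.succ_mul_centralBinom_succ n
  unfold centralRatio
  rw [pow_succ]
  field_simp
  linear_combination 2 * h

theorem sq_centralRatio_mul_le (n : ℕ) : centralRatio n ^ 2 * (2 * n + 1) ≤ 1 := by
  induction n with
  | zero => simp [centralRatio_zero]
  | succ n ih =>
    refine le_trans ?_ ih
    rw [centralRatio_succ, mul_pow, mul_comm (_ ^ 2) (centralRatio n ^ 2), mul_assoc]
    refine mul_le_mul_of_nonneg_left ?_ (sq_nonneg _)
    push_cast
    rw [div_pow, div_mul_eq_mul_div, div_le_iff₀ (by positivity)]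
    nlinarith [(Nat.cast_nonneg n : (0 : ℝ) ≤ n)]

theorem tendsto_centralRatio : Filter.Tendsto centralRatio Filter.atTop (nhds 0) := by
  have h : Filter.Tendsto (fun n => centralRatio n ^ 2) Filter.atTop (nhds 0) := by
    refine squeeze_zero (fun n => sq_nonneg _) (fun n => ?_)
      (tendsto_one_div_add_atTop_nhds_zero_nat (𝕜 := ℝ))
    rw [le_div_iff₀ (by positivity)]
    refine le_trans (mul_le_mul_of_nonneg_left ?_ (sq_nonneg _)) (sq_centralRatio_mul_le n)
    linarith [(Nat.cast_nonneg n : (0 : ℝ) ≤ n)]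
  have := h.sqrt
  simpa [Real.sqrt_sq (centralRatio_nonneg _)] using this

theorem not_summable_centralRatio : ¬ Summable centralRatio := by
  intro h
  refine Real.not_summable_one_div_natCast ((h.mul_left 2).of_nonneg_of_le
    (fun n => by positivity) fun n => ?_)
  rcases Nat.eq_zero_or_pos n with rfl | hn
  · simp [centralRatio_zero]
  · have h4 : (4 : ℝ) ^ n ≤ 2 * n * n.centralBinom :=
      mod_cast Nat.four_pow_le_two_mul_self_mul_centralBinom n hn
    have : (0 : ℝ) < n := mod_cast hn
    unfold centralRatio
    rw [← mul_div_assoc, div_le_div_iff₀ this (by positivity)]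
    linarith

theorem summable_centralRatio_pow_six :
    Summable fun r : ℕ => (4 * (r : ℝ) + 1) * centralRatio r ^ 6 := by
  have hs : Summable fun r : ℕ => 2 * (1 / ((r + 1 : ℕ) : ℝ) ^ 2) :=
    ((summable_nat_add_iff 1).2 (Real.summable_one_div_nat_pow.2 one_lt_two)).mul_left 2
  refine hs.of_nonneg_of_le (fun r => by have := centralRatio_nonneg r; positivity) fun r => ?_
  have h := sq_centralRatio_mul_le r
  have hr : (0 : ℝ) ≤ r := Nat.cast_nonneg r
  have h3 : (centralRatio r ^ 2 * (2 * r + 1)) ^ 3 ≤ 1 :=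
    pow_le_one₀ (by positivity) h
  have h6 : centralRatio r ^ 6 ≤ 1 / (2 * r + 1) ^ 3 := by
    rw [le_div_iff₀ (by positivity)]
    linarith [h3, show (centralRatio r ^ 2 * (2 * r + 1)) ^ 3 =
      centralRatio r ^ 6 * (2 * r + 1) ^ 3 by ring]
  calc (4 * (r : ℝ) + 1) * centralRatio r ^ 6
      ≤ (4 * r + 1) * (1 / (2 * r + 1) ^ 3) := by gcongr
    _ ≤ 2 * (1 / ((r + 1 : ℕ) : ℝ) ^ 2) := by
      push_cast
      rw [mul_one_div, mul_one_div, div_le_div_iff₀ (by positivity) (by positivity)]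
      nlinarith [mul_nonneg hr hr, mul_nonneg (mul_nonneg hr hr) hr]

/-- The coefficient of `sⁱ` in the Legendre polynomial `P₂ᵣ(x)` written in the variable
`s = 1 - x²`. -/
noncomputable def legendreCoeff (r : ℕ) : ℕ → ℝ
  | 0 => 1
  | i + 1 => legendreCoeff r i * (((i : ℝ) - r) * (i + r + 1 / 2) / (i + 1) ^ 2)

theorem legendreCoeff_eq_zero {r i : ℕ} (h : r < i) : legendreCoeff r i = 0 := by
  induction i, h using Nat.le_induction with
  | base => simp [legendreCoeff]
  | succ i _ ih => simp [legendreCoeff, ih]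

theorem legendreCoeff_succ_left (r i : ℕ) :
    legendreCoeff (r + 1) i * ((r + 1 - i) * (2 * r + 1)) =
      legendreCoeff r i * ((r + 1) * (2 * r + 1 + 2 * i)) := by
  induction i with
  | zero => simp [legendreCoeff]
  | succ i ih =>
    simp only [legendreCoeff]
    push_cast
    field_simp
    linear_combination (-(r - i) * (2 * r + 3 + 2 * i : ℝ)) * ih

theorem sum_legendreCoeff_mul_centralRatio_step (r N : ℕ) :
    ∑ i ∈ range (N + 1), ((2 * r + 2) ^ 2 * legendreCoeff (r + 1) i -
      (2 * r + 1) ^ 2 * legendreCoeff r i) * centralRatio i =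
      (4 * r + 3) / (2 * r + 1) * legendreCoeff r N * centralRatio N *
        ((2 * r + 1 + 2 * N) * (2 * N + 1)) := by
  induction N with
  | zero => simp [legendreCoeff, centralRatio_zero]; field_simp; ring
  | succ N ih =>
    rw [sum_range_succ, ih, centralRatio_succ]
    have h := legendreCoeff_succ_left r N
    simp only [legendreCoeff]
    push_cast
    field_simp
    linear_combination (-4 * centralRatio N * (r + 1) ^ 2 * (2 * N + 2 * r + 3)) * h

theorem sum_legendreCoeff_mul_centralRatio (r : ℕ) :
    ∑ i ∈ range (r + 1), legendreCoeff r i * centralRatio i = centralRatio r ^ 2 := by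
  induction r with
  | zero => simp [legendreCoeff, centralRatio_zero]
  | succ r ih =>
    have h := sum_legendreCoeff_mul_centralRatio_step r (r + 1)
    rw [legendreCoeff_eq_zero (Nat.lt_succ_self r)] at h
    simp only [sub_mul, sum_sub_distrib, mul_assoc, ← mul_sum] at h
    rw [sum_range_succ (fun i => legendreCoeff r i * _), ih,
      legendreCoeff_eq_zero (Nat.lt_succ_self r)] at h
    rw [centralRatio_succ]
    field_simp
    linear_combination h

/-- The coefficients `β` with `x²ᵏ = ∑ᵣ (4r + 1) β(k, r) P₂ᵣ(x)`. -/
noncomputable def monomialLegendre (k : ℕ) : ℕ → ℝ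
  | 0 => 1 / (2 * k + 1)
  | r + 1 => monomialLegendre k r * (2 * ((k : ℝ) - r) / (2 * k + 2 * r + 3))

theorem monomialLegendre_eq_zero {k r : ℕ} (h : k < r) : monomialLegendre k r = 0 := by
  induction r, h using Nat.le_induction with
  | base => simp [monomialLegendre]
  | succ i _ ih => simp [monomialLegendre, ih]

theorem monomialLegendre_nonneg (k r : ℕ) : 0 ≤ monomialLegendre k r := by
  induction r with
  | zero => unfold monomialLegendre; positivity
  | succ r ih =>
    rcases le_or_gt r k with h | h
    · have : (0 : ℝ) ≤ k - r := sub_nonneg.2 (mod_cast h)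
      unfold monomialLegendre; positivity
    · rw [monomialLegendre_eq_zero (by omega)]

theorem monomialLegendre_succ_left (k r : ℕ) :
    2 * (k + 1 - r) * (2 * k + 2 * r + 3) * monomialLegendre (k + 1) r =
      (2 * k + 2) * (2 * k + 1) * monomialLegendre k r := by
  induction r with
  | zero => simp [monomialLegendre]; field_simp; ring
  | succ r ih =>
    simp only [monomialLegendre]
    push_cast
    field_simp
    linear_combination ((k - r) * (2 * k + 2 * r + 5) / 2 : ℝ) * ih

theorem sum_monomialLegendre_partial (k R : ℕ) :
    ∑ r ∈ range R, (4 * r + 1) * monomialLegendre k r =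
      1 - (2 * k + 2 * R + 1) * monomialLegendre k R := by
  induction R with
  | zero => simp [monomialLegendre]; field_simp; ring
  | succ R ih =>
    rw [sum_range_succ, ih]
    simp only [monomialLegendre]
    push_cast
    field_simp
    ring

theorem sum_monomialLegendre (k : ℕ) :
    ∑ r ∈ range (k + 1), (4 * r + 1) * monomialLegendre k r = 1 := by
  rw [sum_monomialLegendre_partial, monomialLegendre_eq_zero k.lt_succ_self]
  simp

theorem monomialLegendre_le (k r : ℕ) : (2 * k + 1) * monomialLegendre k r ≤ 1 := by
  rcases lt_or_ge k r with h | h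
  · simp [monomialLegendre_eq_zero h]
  · have h1 := sum_monomialLegendre_partial k r
    have h2 : 0 ≤ ∑ i ∈ range r, (4 * i + 1) * monomialLegendre k i :=
      sum_nonneg fun i _ => mul_nonneg (by positivity) (monomialLegendre_nonneg k i)
    have h3 : 0 ≤ 2 * r * monomialLegendre k r :=
      mul_nonneg (by positivity) (monomialLegendre_nonneg k r)
    linarith

theorem sum_centralRatio_mul_monomialLegendre_step (r K : ℕ) :
    ∑ k ∈ range K, ((2 * r + 2) ^ 2 * (centralRatio k * monomialLegendre k (r + 1)) -
      (2 * r + 1) ^ 2 * (centralRatio k * monomialLegendre k r)) =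
      -(4 * r + 3) * (2 * (K - r) * monomialLegendre K r * centralRatio K) := by
  induction K with
  | zero =>
    rcases Nat.eq_zero_or_pos r with rfl | h
    · simp
    · simp [monomialLegendre_eq_zero h]
  | succ K ih =>
    rw [sum_range_succ, ih, centralRatio_succ]
    have h := monomialLegendre_succ_left K r
    simp only [monomialLegendre]
    push_cast
    field_simp
    linear_combination ((4 * r + 3) * centralRatio K * (2 * K + 1) / 2) * h

theorem hasSum_centralRatio_mul_monomialLegendre_succ {r : ℕ} {S : ℝ}
    (h : HasSum (fun k => centralRatio k * monomialLegendre k r) S) :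
    HasSum (fun k => centralRatio k * monomialLegendre k (r + 1))
      (((2 * r + 1) / (2 * r + 2)) ^ 2 * S) := by
  rw [hasSum_iff_tendsto_nat_of_nonneg fun k =>
    mul_nonneg (centralRatio_nonneg k) (monomialLegendre_nonneg k _)]
  have hG : Filter.Tendsto (fun K : ℕ => 2 * ((K : ℝ) - r) * monomialLegendre K r *
      centralRatio K) Filter.atTop (nhds 0) := by
    refine squeeze_zero_norm (fun K => ?_)
      (by simpa using tendsto_centralRatio.const_mul (2 * r + 1 : ℝ))
    rw [norm_mul, Real.norm_of_nonneg (centralRatio_nonneg K)]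
    refine mul_le_mul_of_nonneg_right ?_ (centralRatio_nonneg K)
    have h0 := monomialLegendre_nonneg K r
    have h1 := monomialLegendre_le K r
    have hK : (0 : ℝ) ≤ K * monomialLegendre K r := by positivity
    have hle : monomialLegendre K r ≤ 1 := by linarith
    have hr : (r : ℝ) * monomialLegendre K r ≤ r := mul_le_of_le_one_right (by positivity) hle
    have hr0 : (0 : ℝ) ≤ r * monomialLegendre K r := by positivity
    rw [Real.norm_eq_abs, abs_le]
    constructor <;> linarith
  have hlim := ((h.tendsto_sum_nat.const_mul ((2 * r + 1 : ℝ) ^ 2)).add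
    (hG.const_mul (-(4 * r + 3 : ℝ)))).const_mul (1 / (2 * r + 2 : ℝ) ^ 2)
  convert hlim using 2 with K
  · have := sum_centralRatio_mul_monomialLegendre_step r K
    rw [sum_sub_distrib, ← mul_sum, ← mul_sum] at this
    rw [← this]
    field_simp
    ring
  · field_simp
    ring

/-- The Legendre operator `d/dx (1 - x²) d/dx` on even polynomials, in the variable
`s = 1 - x²`. -/
noncomputable def legendreOperator : ℝ[X] →ₗ[ℝ] ℝ[X] where
  toFun f := 4 * (1 - X) * (X * derivative (derivative f) + derivative f) - 2 * X * derivative f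
  map_add' f g := by simp only [map_add]; ring
  map_smul' c f := by
    simp only [smul_eq_C_mul, RingHom.id_apply, derivative_C_mul]
    ring

theorem legendreOperator_apply (f : ℝ[X]) : legendreOperator f =
    4 * (1 - X) * (X * derivative (derivative f) + derivative f) - 2 * X * derivative f := rfl

theorem legendreOperator_C_mul (a : ℝ) (f : ℝ[X]) :
    legendreOperator (C a * f) = C a * legendreOperator f := by
  rw [← smul_eq_C_mul, map_smul, smul_eq_C_mul]

theorem coeff_legendreOperator (f : ℝ[X]) (i : ℕ) :
    (legendreOperator f).coeff i =
      4 * (i + 1) ^ 2 * f.coeff (i + 1) - (4 * i ^ 2 + 2 * i) * f.coeff i := by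
  have h : legendreOperator f = C 4 * (X * derivative (derivative f)) + C 4 * derivative f -
      C 4 * (X * (X * derivative (derivative f))) - C 6 * (X * derivative f) := by
    rw [legendreOperator_apply]
    simp only [map_ofNat]
    ring
  rw [h]
  rcases i with _ | _ | i
  · simp [coeff_derivative]
  · simp [coeff_derivative]; ring
  · simp [coeff_derivative]; ring

theorem eq_zero_of_legendreOperator_eq {f : ℝ[X]} {c : ℝ}
    (h : legendreOperator f + C c * f = 0) (h0 : f.coeff 0 = 0) : f = 0 := by
  ext i
  rw [coeff_zero]
  induction i with
  | zero => exact h0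
  | succ i ih =>
    have hi := congrArg (fun g => g.coeff i) h
    simp only [coeff_add, coeff_legendreOperator, coeff_C_mul, ih, coeff_zero, mul_zero,
      sub_zero, add_zero] at hi
    have : (4 * ((i : ℝ) + 1) ^ 2) ≠ 0 := by positivity
    exact (mul_eq_zero.1 hi).resolve_left this

/-- The Legendre polynomial `P₂ᵣ(x)` in the variable `s = 1 - x²`. -/
noncomputable def evenLegendre (r : ℕ) : ℝ[X] :=
  ∑ i ∈ range (r + 1), C (legendreCoeff r i) * X ^ i

theorem coeff_evenLegendre (r i : ℕ) : (evenLegendre r).coeff i = legendreCoeff r i := by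
  simp only [evenLegendre, finsetSum_coeff, coeff_C_mul_X_pow, Finset.sum_ite_eq, mem_range]
  split_ifs with h
  · rfl
  · rw [legendreCoeff_eq_zero (by omega)]

theorem legendreOperator_evenLegendre (r : ℕ) :
    legendreOperator (evenLegendre r) = -(C (2 * r * (2 * r + 1) : ℝ) * evenLegendre r) := by
  ext i
  rw [coeff_legendreOperator, coeff_neg, coeff_C_mul, coeff_evenLegendre, coeff_evenLegendre]
  simp only [legendreCoeff]
  field_simp
  ring

theorem eq_sum_evenLegendre {F : ℕ → ℝ[X]} {e : ℕ → ℝ} (hF0 : F 0 = C (e 0))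
    (hF : ∀ k : ℕ, legendreOperator (F (k + 1)) + C ((2 * k + 2) * (2 * k + 3) : ℝ) * F (k + 1) =
      C ((2 * k + 2) * (2 * k + 1) : ℝ) * F k)
    (hc : ∀ k, (F k).coeff 0 = ∑ r ∈ range (k + 1), (4 * r + 1) * monomialLegendre k r * e r)
    (k : ℕ) :
    F k = ∑ r ∈ range (k + 1), C ((4 * r + 1) * monomialLegendre k r * e r) * evenLegendre r := by
  induction k with
  | zero => simp [hF0, evenLegendre, monomialLegendre, legendreCoeff]
  | succ k ih =>
    rw [← sub_eq_zero]
    refine eq_zero_of_legendreOperator_eq (c := (2 * k + 2) * (2 * k + 3)) ?_ ?_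
    · have hterm : ∀ r : ℕ,
          legendreOperator (C ((4 * r + 1) * monomialLegendre (k + 1) r * e r) * evenLegendre r) +
            C ((2 * k + 2) * (2 * k + 3) : ℝ) *
              (C ((4 * r + 1) * monomialLegendre (k + 1) r * e r) * evenLegendre r) =
          C ((2 * k + 2) * (2 * k + 1) : ℝ) *
            (C ((4 * r + 1) * monomialLegendre k r * e r) * evenLegendre r) := by
        intro r
        have h := congrArg C (monomialLegendre_succ_left k r)
        rw [legendreOperator_C_mul, legendreOperator_evenLegendre]
        simp only [C_mul, C_add, C_sub, map_one, map_ofNat] at h ⊢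
        linear_combination (4 * C (r : ℝ) + 1) * C (e r) * evenLegendre r * h
      rw [map_sub, mul_sub, sub_add_sub_comm, hF, ih, map_sum, mul_sum (range (k + 1 + 1)),
        ← sum_add_distrib, sum_congr rfl fun r _ => hterm r, ← mul_sum, sum_range_succ _ (k + 1),
        monomialLegendre_eq_zero k.lt_succ_self]
      simp
    · rw [coeff_sub, hc, finsetSum_coeff, sub_eq_zero]
      exact sum_congr rfl fun r _ => by simp [coeff_evenLegendre, legendreCoeff]

theorem legendreOperator_pow_mul_pow (m j : ℕ) :
    legendreOperator ((1 - X) ^ m * X ^ j) +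
        C ((2 * (m + j)) * (2 * (m + j) + 1) : ℝ) * ((1 - X) ^ m * X ^ j) =
      C (2 * m * (2 * m - 1) : ℝ) * ((1 - X) ^ (m - 1) * X ^ j) +
        C (4 * j ^ 2 : ℝ) * ((1 - X) ^ m * X ^ (j - 1)) := by
  rw [legendreOperator_apply]
  rcases m with _ | _ | m <;> rcases j with _ | _ | j <;> 
    simp [derivative_pow, show (C 2 : ℝ[X]) = 2 from map_ofNat C 2,
      show (C 4 : ℝ[X]) = 4 from map_ofNat C 4] <;> ring

/-- The weight of `(A²)ᵐ (B²)ʲ` in the mean of `(A - B cos θ)²⁽ᵐ⁺ʲ⁾`. -/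
noncomputable def meanWeight (m j : ℕ) : ℝ :=
  ((2 * m + 2 * j).choose (2 * m) : ℝ) * centralRatio j

theorem meanWeight_succ_left (m j : ℕ) :
    meanWeight (m + 1) j * (2 * (m + 1) * (2 * (m + 1) - 1)) =
      (2 * (m + j) + 2) * (2 * (m + j) + 1) * meanWeight m j := by
  unfold meanWeight
  rw [Nat.cast_add_choose, Nat.cast_add_choose, show 2 * (m + 1) + 2 * j = 2 * m + 2 * j + 1 + 1 by
    ring, show 2 * (m + 1) = 2 * m + 1 + 1 by ring]
  simp only [Nat.factorial_succ]
  push_cast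
  field_simp
  ring

theorem meanWeight_succ_right (m j : ℕ) :
    meanWeight m (j + 1) * (4 * (j + 1) ^ 2) =
      (2 * (m + j) + 2) * (2 * (m + j) + 1) * meanWeight m j := by
  unfold meanWeight
  rw [Nat.cast_add_choose, Nat.cast_add_choose, show 2 * m + 2 * (j + 1) = 2 * m + 2 * j + 1 + 1 by
    ring, show 2 * (j + 1) = 2 * j + 1 + 1 by ring, centralRatio_succ]
  simp only [Nat.factorial_succ]
  push_cast
  field_simp
  ring

/-- The mean of `(cos α cos β - sin α sin β cos θ)²ᵏ` over `θ`, as a polynomial in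
`sin² α` for fixed `S = sin² β`. -/
noncomputable def meanPolynomial (S : ℝ) (k : ℕ) : ℝ[X] :=
  ∑ p ∈ antidiagonal k, C (meanWeight p.1 p.2 * ((1 - S) ^ p.1 * S ^ p.2)) *
    ((1 - X) ^ p.1 * X ^ p.2)

theorem legendreOperator_meanPolynomial (S : ℝ) (k : ℕ) :
    legendreOperator (meanPolynomial S (k + 1)) +
        C ((2 * k + 2) * (2 * k + 3) : ℝ) * meanPolynomial S (k + 1) =
      C ((2 * k + 2) * (2 * k + 1) : ℝ) * meanPolynomial S k := by
  have hterm : ∀ p ∈ antidiagonal (k + 1),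
      legendreOperator (C (meanWeight p.1 p.2 * ((1 - S) ^ p.1 * S ^ p.2)) *
        ((1 - X) ^ p.1 * X ^ p.2)) + C ((2 * k + 2) * (2 * k + 3) : ℝ) *
          (C (meanWeight p.1 p.2 * ((1 - S) ^ p.1 * S ^ p.2)) * ((1 - X) ^ p.1 * X ^ p.2)) =
      C (meanWeight p.1 p.2 * (2 * p.1 * (2 * p.1 - 1)) * ((1 - S) ^ p.1 * S ^ p.2)) *
          ((1 - X) ^ (p.1 - 1) * X ^ p.2) +
        C (meanWeight p.1 p.2 * (4 * p.2 ^ 2) * ((1 - S) ^ p.1 * S ^ p.2)) *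
          ((1 - X) ^ p.1 * X ^ (p.2 - 1)) := by
    rintro ⟨m, j⟩ hp
    have hk : (m : ℝ) + j = k + 1 := mod_cast mem_antidiagonal.1 hp
    have h := legendreOperator_pow_mul_pow m j
    rw [hk] at h
    rw [legendreOperator_C_mul, show (2 * k + 2 : ℝ) * (2 * k + 3) =
      2 * (k + 1) * (2 * (k + 1) + 1) by ring]
    simp only [C_mul] at h ⊢
    linear_combination C (meanWeight m j) * (C ((1 - S) ^ m) * C (S ^ j)) * h
  rw [meanPolynomial, map_sum, mul_sum, ← sum_add_distrib, sum_congr rfl hterm, sum_add_distrib,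
    Nat.sum_antidiagonal_succ, Nat.sum_antidiagonal_succ', meanPolynomial, mul_sum]
  simp only [Nat.cast_zero, mul_zero, zero_mul, C_0, zero_add, zero_pow two_ne_zero,
    add_tsub_cancel_right, Nat.cast_add, Nat.cast_one]
  rw [← sum_add_distrib]
  refine sum_congr rfl fun p hp => ?_
  have hk : (p.1 : ℝ) + p.2 = k := mod_cast mem_antidiagonal.1 hp
  rw [meanWeight_succ_left, meanWeight_succ_right, hk, ← add_mul, ← C_add, ← mul_assoc (C _) (C _),
    ← C_mul]
  congr 2
  ring

theorem one_sub_X_pow_eq_sum_evenLegendre (k : ℕ) :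
    (1 - X : ℝ[X]) ^ k =
      ∑ r ∈ range (k + 1), C ((4 * r + 1) * monomialLegendre k r) * evenLegendre r := by
  have := eq_sum_evenLegendre (F := fun k => (1 - X) ^ k) (e := fun _ => 1) (by simp)
    (fun k => ?_) (fun k => ?_) k
  · simpa using this
  · have h := legendreOperator_pow_mul_pow (k + 1) 0
    simp only [pow_zero, mul_one, Nat.add_sub_cancel, Nat.cast_zero, add_zero] at h
    rw [show (2 * k + 2 : ℝ) * (2 * k + 3) = 2 * (k + 1 : ℕ) * (2 * (k + 1 : ℕ) + 1) by
      push_cast; ring, h]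
    simp only [ne_eq, OfNat.ofNat_ne_zero, not_false_eq_true, zero_pow, mul_zero, map_zero,
      zero_mul, add_zero]
    push_cast
    congr 2
    ring
  · simp [coeff_zero_eq_eval_zero, sum_monomialLegendre]

theorem meanPolynomial_eq_sum_evenLegendre (S : ℝ) (k : ℕ) :
    meanPolynomial S k = ∑ r ∈ range (k + 1),
      C ((4 * r + 1) * monomialLegendre k r * (evenLegendre r).eval S) * evenLegendre r := by
  refine eq_sum_evenLegendre ?_ (legendreOperator_meanPolynomial S) (fun k => ?_) k
  · simp [meanPolynomial, meanWeight, centralRatio_zero, evenLegendre, legendreCoeff]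
  · have h := congrArg (eval S) (one_sub_X_pow_eq_sum_evenLegendre k)
    simp only [eval_pow, eval_sub, eval_one, eval_X, eval_finsetSum, eval_mul, eval_C] at h
    rw [← h, meanPolynomial, coeff_zero_eq_eval_zero, eval_finsetSum,
      sum_eq_single_of_mem (k, 0) (by simp)]
    · simp [meanWeight, centralRatio_zero]
    · rintro ⟨m, j⟩ hp hne
      have : j ≠ 0 := by
        rintro rfl
        exact hne (by simpa using hp)
      simp [this]

theorem integral_sin_pow_two_mul (n : ℕ) :
    ∫ x in (0 : ℝ)..Real.pi, Real.sin x ^ (2 * n) = Real.pi * centralRatio n := by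
  induction n with
  | zero => simp [centralRatio_zero]
  | succ n ih =>
    rw [show 2 * (n + 1) = 2 * n + 2 by ring, integral_sin_pow, ih, centralRatio_succ]
    simp
    ring

theorem integral_cos_pow_two_mul (n : ℕ) :
    ∫ x in (0 : ℝ)..Real.pi, Real.cos x ^ (2 * n) = Real.pi * centralRatio n := by
  induction n with
  | zero => simp [centralRatio_zero]
  | succ n ih =>
    rw [show 2 * (n + 1) = 2 * n + 2 by ring, integral_cos_pow, ih, centralRatio_succ]
    simp
    ring

theorem integral_cos_pow_two_mul_add_one (n : ℕ) :
    ∫ x in (0 : ℝ)..Real.pi, Real.cos x ^ (2 * n + 1) = 0 := by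
  induction n with
  | zero => simp
  | succ n ih =>
    rw [show 2 * (n + 1) + 1 = 2 * n + 1 + 2 by ring, integral_cos_pow, ih]
    simp

theorem integral_evenLegendre_sin_sq (r : ℕ) :
    ∫ x in (0 : ℝ)..Real.pi, (evenLegendre r).eval (Real.sin x ^ 2) =
      Real.pi * centralRatio r ^ 2 := by
  simp only [evenLegendre, eval_finsetSum, eval_mul, eval_C, eval_pow, eval_X, ← pow_mul]
  rw [intervalIntegral.integral_finsetSum fun i _ =>
    Continuous.intervalIntegrable (by fun_prop) _ _]
  simp only [intervalIntegral.integral_const_mul, integral_sin_pow_two_mul]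
  rw [← sum_legendreCoeff_mul_centralRatio, mul_sum]
  exact sum_congr rfl fun i _ => by ring

theorem sum_range_two_mul_add_one {M : Type*} [AddCommMonoid M] {g : ℕ → M}
    (hg : ∀ j, g (2 * j + 1) = 0) (k : ℕ) :
    ∑ i ∈ range (2 * k + 1), g i = ∑ j ∈ range (k + 1), g (2 * j) := by
  induction k with
  | zero => simp
  | succ k ih =>
    rw [show 2 * (k + 1) + 1 = 2 * k + 1 + 1 + 1 by ring, sum_range_succ, sum_range_succ, ih,
      hg, add_zero, sum_range_succ _ (k + 1)]
    rfl

theorem integral_sub_mul_cos_pow (A B : ℝ) (k : ℕ) :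
    ∫ x in (0 : ℝ)..Real.pi, (A - B * Real.cos x) ^ (2 * k) =
      Real.pi * ∑ p ∈ antidiagonal k, meanWeight p.1 p.2 * ((A ^ 2) ^ p.1 * (B ^ 2) ^ p.2) := by
  have hexp : ∀ x : ℝ, (A - B * Real.cos x) ^ (2 * k) = ∑ i ∈ range (2 * k + 1),
      ((2 * k).choose i * (-B) ^ i * A ^ (2 * k - i)) * Real.cos x ^ i := by
    intro x
    rw [sub_eq_neg_add, add_pow]
    exact sum_congr rfl fun i _ => by rw [← neg_mul, mul_pow]; ring
  simp only [hexp]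
  rw [intervalIntegral.integral_finsetSum fun i _ =>
    Continuous.intervalIntegrable (by fun_prop) _ _]
  simp only [intervalIntegral.integral_const_mul]
  rw [sum_range_two_mul_add_one (fun j => by rw [integral_cos_pow_two_mul_add_one, mul_zero]),
    ← Nat.sum_antidiagonal_swap, Nat.sum_antidiagonal_eq_sum_range_succ_mk, mul_sum]
  refine sum_congr rfl fun j hj => ?_
  obtain ⟨m, rfl⟩ := Nat.exists_eq_add_of_le (mem_range_succ_iff.1 hj)
  rw [integral_cos_pow_two_mul]
  simp only [Prod.swap_prod_mk, meanWeight, add_tsub_cancel_left, mul_add, pow_mul, neg_sq]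
  rw [Nat.choose_symm_add, add_comm (2 * j)]
  ring

theorem integral_mean_pow (α β : ℝ) (k : ℕ) :
    ∫ θ in (0 : ℝ)..Real.pi, (Real.cos α * Real.cos β -
        Real.sin α * Real.sin β * Real.cos θ) ^ (2 * k) =
      Real.pi * ∑ r ∈ range (k + 1), (4 * r + 1) * monomialLegendre k r *
        (evenLegendre r).eval (Real.sin β ^ 2) * (evenLegendre r).eval (Real.sin α ^ 2) := by
  rw [integral_sub_mul_cos_pow]
  have h := congrArg (eval (Real.sin α ^ 2)) (meanPolynomial_eq_sum_evenLegendre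
    (Real.sin β ^ 2) k)
  simp only [meanPolynomial, eval_finsetSum, eval_mul, eval_C, eval_pow, eval_sub, eval_one,
    eval_X] at h
  rw [← h]
  congr 1
  refine sum_congr rfl fun p _ => ?_
  rw [← Real.cos_sq', ← Real.cos_sq', mul_assoc, mul_pow _ _ 2, mul_pow _ _ 2, mul_pow, mul_pow]
  ring

theorem lintegral_cube_pow (k : ℕ) :
    (∫⁻ p : ℝ × ℝ × ℝ in Set.Icc 0 Real.pi ×ˢ Set.Icc 0 Real.pi ×ˢ Set.Icc 0 Real.pi,
      ENNReal.ofReal ((Real.cos p.1 * Real.cos p.2.1 -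
          Real.sin p.1 * Real.sin p.2.1 * Real.cos p.2.2) ^ (2 * k))) =
      ENNReal.ofReal (∑ r ∈ range (k + 1),
        Real.pi ^ 3 * ((4 * r + 1) * monomialLegendre k r * centralRatio r ^ 4)) := by
  have hcont : Continuous fun p : ℝ × ℝ × ℝ => (Real.cos p.1 * Real.cos p.2.1 -
      Real.sin p.1 * Real.sin p.2.1 * Real.cos p.2.2) ^ (2 * k) := by fun_prop
  have hcpt : IsCompact (Set.Icc (0 : ℝ) Real.pi ×ˢ Set.Icc (0 : ℝ) Real.pi ×ˢ
      Set.Icc (0 : ℝ) Real.pi) := isCompact_Icc.prod (isCompact_Icc.prod isCompact_Icc)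
  have hint := hcont.continuousOn.integrableOn_compact (μ := volume) hcpt
  rw [← ofReal_integral_eq_lintegral_ofReal hint
    (Filter.Eventually.of_forall fun p => (even_two_mul k).pow_nonneg _)]
  congr 1
  rw [Measure.volume_eq_prod] at hint ⊢
  rw [setIntegral_prod _ hint]
  have hinner : ∀ α : ℝ, ∫ q : ℝ × ℝ in Set.Icc 0 Real.pi ×ˢ Set.Icc 0 Real.pi,
      (Real.cos α * Real.cos q.1 - Real.sin α * Real.sin q.1 * Real.cos q.2) ^ (2 * k) =
      ∑ r ∈ range (k + 1), Real.pi ^ 2 * ((4 * r + 1) * monomialLegendre k r *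
        centralRatio r ^ 2) * (evenLegendre r).eval (Real.sin α ^ 2) := by
    intro α
    have hint' : IntegrableOn (fun q : ℝ × ℝ => (Real.cos α * Real.cos q.1 -
        Real.sin α * Real.sin q.1 * Real.cos q.2) ^ (2 * k))
        (Set.Icc 0 Real.pi ×ˢ Set.Icc 0 Real.pi) volume :=
      Continuous.continuousOn (by fun_prop) |>.integrableOn_compact
        (isCompact_Icc.prod isCompact_Icc)
    rw [Measure.volume_eq_prod] at hint' ⊢
    rw [setIntegral_prod _ hint']
    simp only [integral_Icc_eq_integral_Ioc, ← intervalIntegral.integral_of_le Real.pi_pos.le,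
      integral_mean_pow, intervalIntegral.integral_const_mul]
    rw [intervalIntegral.integral_finsetSum fun r _ =>
      Continuous.intervalIntegrable (by fun_prop) _ _, mul_sum]
    refine sum_congr rfl fun r _ => ?_
    rw [intervalIntegral.integral_mul_const, intervalIntegral.integral_const_mul,
      integral_evenLegendre_sin_sq]
    ring
  simp only [hinner, integral_Icc_eq_integral_Ioc,
    ← intervalIntegral.integral_of_le Real.pi_pos.le]
  rw [intervalIntegral.integral_finsetSum fun r _ =>
    Continuous.intervalIntegrable (by fun_prop) _ _]
  refine sum_congr rfl fun r _ => ?_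
  rw [intervalIntegral.integral_const_mul, integral_evenLegendre_sin_sq]
  ring

theorem multichoose_half_eq_centralRatio (n : ℕ) :
    Ring.multichoose (1 / 2 : ℝ) n = centralRatio n := by
  have h : ∀ n : ℕ, (n.factorial : ℝ) * centralRatio n = (ascPochhammer ℝ n).eval (1 / 2) := by
    intro n
    induction n with
    | zero => simp [centralRatio_zero]
    | succ n ih =>
      rw [ascPochhammer_succ_eval, ← ih, centralRatio_succ, Nat.factorial_succ]
      push_cast
      field_simp
      ring
  have h1 := Ring.factorial_nsmul_multichoose_eq_ascPochhammer (1 / 2 : ℝ) n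
  rw [ascPochhammer_smeval_eq_eval, ← h, nsmul_eq_mul] at h1
  exact mul_left_cancel₀ (by positivity) h1

theorem hasSum_centralRatio_mul_pow {y : ℝ} (h0 : 0 ≤ y) (h1 : y < 1) :
    HasSum (fun k => centralRatio k * y ^ k) (1 / Real.sqrt (1 - y)) := by
  have h := (Real.one_div_one_sub_rpow_hasFPowerSeriesOnBall_zero (1 / 2)).hasSum (y := y)
    (by simpa [← ofReal_norm, abs_of_nonneg h0] using h1)
  rw [zero_add, ← Real.sqrt_eq_rpow] at h
  refine HasSum.congr_fun h fun k => ?_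
  rw [FormalMultilinearSeries.ofScalars_apply_eq, Ring.choose, smul_eq_mul,
    ← multichoose_half_eq_centralRatio]
  congr 2
  ring

theorem tsum_ofReal_centralRatio_mul_pow {y : ℝ} (h0 : 0 ≤ y) (h1 : y < 1) :
    ∑' k, ENNReal.ofReal (centralRatio k * y ^ k) = ENNReal.ofReal (1 / Real.sqrt (1 - y)) := by
  have h := hasSum_centralRatio_mul_pow h0 h1
  rw [← h.tsum_eq, ENNReal.ofReal_tsum_of_nonneg _ h.summable]
  exact fun k => mul_nonneg (centralRatio_nonneg k) (pow_nonneg h0 k)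

theorem tsum_ofReal_centralRatio_mul_pow_eq_top {y : ℝ} (h1 : 1 ≤ y) :
    ∑' k, ENNReal.ofReal (centralRatio k * y ^ k) = ⊤ := by
  by_contra hne
  refine not_summable_centralRatio ?_
  have h := ENNReal.summable_toReal hne
  refine h.of_nonneg_of_le centralRatio_nonneg fun k => ?_
  rw [ENNReal.toReal_ofReal
    (mul_nonneg (centralRatio_nonneg k) (pow_nonneg (zero_le_one.trans h1) k))]
  exact le_mul_of_one_le_right (centralRatio_nonneg k) (one_le_pow₀ h1)

theorem lintegral_one_div_sqrt_one_sub_sq :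
    ∫⁻ x in Set.Ioc (0 : ℝ) 1, ENNReal.ofReal (1 / Real.sqrt (1 - x ^ 2)) =
      ENNReal.ofReal (Real.pi / 2) := by
  have hderiv : ∀ x ∈ Set.Ioo (0 : ℝ) 1,
      HasDerivAt Real.arcsin (1 / Real.sqrt (1 - x ^ 2)) x := fun x hx =>
    Real.hasDerivAt_arcsin (by linarith [hx.1]) (by linarith [hx.2])
  have hint := intervalIntegral.integrableOn_deriv_of_nonneg
    Real.continuous_arcsin.continuousOn hderiv (fun x _ => by positivity)
  rw [← ofReal_integral_eq_lintegral_ofReal hint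
    (Filter.Eventually.of_forall fun x => by positivity),
    ← intervalIntegral.integral_of_le zero_le_one,
    intervalIntegral.integral_eq_sub_of_hasDerivAt_of_le zero_le_one
      Real.continuous_arcsin.continuousOn hderiv
      ((intervalIntegrable_iff_integrableOn_Ioc_of_le zero_le_one).2 hint)]
  simp

theorem lintegral_Ioc_ofReal_pow (n : ℕ) :
    ∫⁻ x in Set.Ioc (0 : ℝ) 1, ENNReal.ofReal (x ^ n) = ENNReal.ofReal (1 / (n + 1)) := by
  have hint : IntegrableOn (fun x : ℝ => x ^ n) (Set.Ioc 0 1) volume :=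
    (intervalIntegrable_iff_integrableOn_Ioc_of_le zero_le_one).1
      (Continuous.intervalIntegrable (by fun_prop) _ _)
  rw [← ofReal_integral_eq_lintegral_ofReal hint, ← intervalIntegral.integral_of_le zero_le_one,
    integral_pow]
  · simp
  · filter_upwards [ae_restrict_mem measurableSet_Ioc] with x hx
    exact pow_nonneg hx.1.le n

theorem hasSum_centralRatio_mul_monomialLegendre_zero :
    HasSum (fun k => centralRatio k * monomialLegendre k 0) (Real.pi / 2) := by
  have hnn : ∀ k, 0 ≤ centralRatio k * monomialLegendre k 0 := fun k =>
    mul_nonneg (centralRatio_nonneg k) (monomialLegendre_nonneg k 0)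
  have h : ∑' k, ENNReal.ofReal (centralRatio k * monomialLegendre k 0) =
      ENNReal.ofReal (Real.pi / 2) := by
    rw [← lintegral_one_div_sqrt_one_sub_sq]
    have hae : ∀ᵐ x ∂volume.restrict (Set.Ioc (0 : ℝ) 1),
        ENNReal.ofReal (1 / Real.sqrt (1 - x ^ 2)) =
          ∑' k, ENNReal.ofReal (centralRatio k * (x ^ 2) ^ k) := by
      filter_upwards [ae_restrict_mem measurableSet_Ioc,
        ae_restrict_of_ae (Measure.ae_ne volume (1 : ℝ))] with x hx hx1
      refine (tsum_ofReal_centralRatio_mul_pow (sq_nonneg x) ?_).symm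
      have := lt_of_le_of_ne hx.2 hx1
      nlinarith [hx.1]
    rw [lintegral_congr_ae hae, lintegral_tsum fun k => by fun_prop]
    refine tsum_congr fun k => ?_
    simp only [ENNReal.ofReal_mul (centralRatio_nonneg k), ← pow_mul]
    rw [lintegral_const_mul _ (by fun_prop), lintegral_Ioc_ofReal_pow]
    simp [monomialLegendre]
  have hsum := ENNReal.hasSum_toReal (h ▸ ENNReal.ofReal_ne_top :
    ∑' k, ENNReal.ofReal (centralRatio k * monomialLegendre k 0) ≠ ⊤)
  rw [← ENNReal.tsum_toReal_eq fun _ => ENNReal.ofReal_ne_top, h,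
    ENNReal.toReal_ofReal (by positivity)] at hsum
  simpa only [ENNReal.toReal_ofReal (hnn _)] using hsum

theorem hasSum_centralRatio_mul_monomialLegendre (r : ℕ) :
    HasSum (fun k => centralRatio k * monomialLegendre k r)
      (Real.pi / 2 * centralRatio r ^ 2) := by
  induction r with
  | zero => simpa [centralRatio_zero] using hasSum_centralRatio_mul_monomialLegendre_zero
  | succ r ih =>
    convert hasSum_centralRatio_mul_monomialLegendre_succ ih using 1
    rw [centralRatio_succ]
    ring

theorem tsum_lintegral_cube_pow :
    ∑' k : ℕ, ∫⁻ p : ℝ × ℝ × ℝ in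
      Set.Icc 0 Real.pi ×ˢ Set.Icc 0 Real.pi ×ˢ Set.Icc 0 Real.pi,
        ENNReal.ofReal (centralRatio k * ((Real.cos p.1 * Real.cos p.2.1 -
          Real.sin p.1 * Real.sin p.2.1 * Real.cos p.2.2) ^ 2) ^ k) =
      ENNReal.ofReal (Real.pi ^ 4 / 2 *
        ∑' r : ℕ, (4 * (r : ℝ) + 1) * centralRatio r ^ 6) := by
  have hnn : ∀ k r : ℕ, 0 ≤ Real.pi ^ 3 * ((4 * r + 1) * monomialLegendre k r *
      centralRatio r ^ 4) := fun k r => by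
    have := monomialLegendre_nonneg k r
    have := centralRatio_nonneg r
    positivity
  have hk : ∀ k : ℕ, ∫⁻ p : ℝ × ℝ × ℝ in
      Set.Icc 0 Real.pi ×ˢ Set.Icc 0 Real.pi ×ˢ Set.Icc 0 Real.pi,
        ENNReal.ofReal (centralRatio k * ((Real.cos p.1 * Real.cos p.2.1 -
          Real.sin p.1 * Real.sin p.2.1 * Real.cos p.2.2) ^ 2) ^ k) =
      ∑' r : ℕ, ENNReal.ofReal (Real.pi ^ 3 * ((4 * r + 1) * centralRatio r ^ 4)) *
        ENNReal.ofReal (centralRatio k * monomialLegendre k r) := by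
    intro k
    simp only [ENNReal.ofReal_mul (centralRatio_nonneg k), ← pow_mul]
    rw [lintegral_const_mul _ (by fun_prop), lintegral_cube_pow,
      ENNReal.ofReal_sum_of_nonneg fun r _ => hnn k r, mul_sum,
      tsum_eq_sum (s := range (k + 1))]
    · refine sum_congr rfl fun r _ => ?_
      have := centralRatio_nonneg r
      rw [← ENNReal.ofReal_mul (centralRatio_nonneg k),
        ← ENNReal.ofReal_mul (centralRatio_nonneg k), ← ENNReal.ofReal_mul (by positivity)]
      congr 1
      ring
    · intro r hr
      rw [monomialLegendre_eq_zero (by simpa using hr)]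
      simp
  simp only [hk]
  rw [ENNReal.tsum_comm, ← tsum_mul_left, ENNReal.ofReal_tsum_of_nonneg
    (fun r => by have := centralRatio_nonneg r; positivity)
    (summable_centralRatio_pow_six.mul_left _)]
  refine tsum_congr fun r => ?_
  have h := hasSum_centralRatio_mul_monomialLegendre r
  have := centralRatio_nonneg r
  rw [ENNReal.tsum_mul_left, ← ENNReal.ofReal_tsum_of_nonneg
    (fun k => mul_nonneg (centralRatio_nonneg k) (monomialLegendre_nonneg k r)) h.summable,
    h.tsum_eq, ← ENNReal.ofReal_mul (by positivity)]
  congr 1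
  ring

/-- **Identity (5.8).**
`∫_{[0,π]³} (1 - (cos α cos β - sin α sin β cos θ)²)^{-1/2} dα dβ dθ
  = (π⁴/2) ∑_{r≥0} (4r+1) 4^{-6r} C(2r,r)⁶`. -/
theorem six_cycle_integral_eq_spectral_series :
    (∫⁻ p : ℝ × ℝ × ℝ in
        Set.Icc 0 Real.pi ×ˢ Set.Icc 0 Real.pi ×ˢ Set.Icc 0 Real.pi,
      ENNReal.ofReal (1 / Real.sqrt (1 -
        (Real.cos p.1 * Real.cos p.2.1 -
          Real.sin p.1 * Real.sin p.2.1 * Real.cos p.2.2) ^ 2))) =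
      ENNReal.ofReal (Real.pi ^ 4 / 2 *
        ∑' r : ℕ, (4 * (r : ℝ) + 1) * ((r.centralBinom : ℝ)) ^ 6 / 4 ^ (6 * r)) := by
  have hseries : ∀ r : ℕ, (4 * (r : ℝ) + 1) * (r.centralBinom : ℝ) ^ 6 / 4 ^ (6 * r) =
      (4 * (r : ℝ) + 1) * centralRatio r ^ 6 := fun r => by
    rw [centralRatio, div_pow, ← pow_mul, mul_comm r 6, mul_div_assoc]
  have hmeas : ∀ k : ℕ, Measurable fun p : ℝ × ℝ × ℝ => ENNReal.ofReal (centralRatio k *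
      ((Real.cos p.1 * Real.cos p.2.1 -
        Real.sin p.1 * Real.sin p.2.1 * Real.cos p.2.2) ^ 2) ^ k) := fun k => by fun_prop
  simp only [hseries]
  rw [← tsum_lintegral_cube_pow, ← lintegral_tsum fun k => (hmeas k).aemeasurable]
  have hfin : ∫⁻ p : ℝ × ℝ × ℝ in
      Set.Icc 0 Real.pi ×ˢ Set.Icc 0 Real.pi ×ˢ Set.Icc 0 Real.pi,
      ∑' k : ℕ, ENNReal.ofReal (centralRatio k * ((Real.cos p.1 * Real.cos p.2.1 -
        Real.sin p.1 * Real.sin p.2.1 * Real.cos p.2.2) ^ 2) ^ k) ≠ ⊤ := by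
    rw [lintegral_tsum fun k => (hmeas k).aemeasurable, tsum_lintegral_cube_pow]
    exact ENNReal.ofReal_ne_top
  refine lintegral_congr_ae ?_
  filter_upwards [ae_lt_top (Measurable.tsum hmeas) hfin] with p hp
  refine (tsum_ofReal_centralRatio_mul_pow (sq_nonneg _) ?_).symm
  by_contra! hge
  exact hp.ne (tsum_ofReal_centralRatio_mul_pow_eq_top hge)
end
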